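/- With B_1 = F_1 - c_1 E_2 K_1^{-1}, B_2 = F_2 - c_2 E_1 K_2^{-1}, K = K_1 K_2^{-1}, and C_1 = B_1 B_2 - q B_2 B_1 - c_2 K/(q-q^{-1}) + (q+q^{-1}) c_1 K^{-1}/(q-q^{-1}), the following commutation relations hold in U_q(sl3): K B_1 = q^{-3} B_1 K, K B_2 = q^3 B_2 K, C_1 B_1 = q B_1 C_1, and C_1 B_2 = q^{-1} B_2 C_1. -/

import Mathlib

noncomputable section

/-- The defining relations of `U_q(sl3)` inside a `ℂ`-algebra `R`, with real `q`. -/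
structure UqSL3 (R : Type*) [Ring R] [Algebra ℂ R] (q : ℝ)
    (E₁ E₂ F₁ F₂ K₁ K₁' K₂ K₂' : R) : Prop where
  K₁mul : K₁ * K₁' = 1
  K₁mul' : K₁' * K₁ = 1
  K₂mul : K₂ * K₂' = 1
  K₂mul' : K₂' * K₂ = 1
  Kcomm : K₁ * K₂ = K₂ * K₁
  Kcomm' : K₁ * K₂' = K₂' * K₁
  Kcomm'' : K₁' * K₂ = K₂ * K₁'
  KE11 : K₁ * E₁ = ((q:ℂ) ^ (2:ℤ)) • (E₁ * K₁)
  KE12 : K₁ * E₂ = ((q:ℂ) ^ (-1:ℤ)) • (E₂ * K₁)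
  KE21 : K₂ * E₁ = ((q:ℂ) ^ (-1:ℤ)) • (E₁ * K₂)
  KE22 : K₂ * E₂ = ((q:ℂ) ^ (2:ℤ)) • (E₂ * K₂)
  KF11 : K₁ * F₁ = ((q:ℂ) ^ (-2:ℤ)) • (F₁ * K₁)
  KF12 : K₁ * F₂ = ((q:ℂ) ^ (1:ℤ)) • (F₂ * K₁)
  KF21 : K₂ * F₁ = ((q:ℂ) ^ (1:ℤ)) • (F₁ * K₂)
  KF22 : K₂ * F₂ = ((q:ℂ) ^ (-2:ℤ)) • (F₂ * K₂)
  EF11 : E₁ * F₁ - F₁ * E₁ = ((q:ℂ) - (q:ℂ)⁻¹)⁻¹ • (K₁ - K₁')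
  EF22 : E₂ * F₂ - F₂ * E₂ = ((q:ℂ) - (q:ℂ)⁻¹)⁻¹ • (K₂ - K₂')
  EF12 : E₁ * F₂ = F₂ * E₁
  EF21 : E₂ * F₁ = F₁ * E₂
  serreE₁ : E₁ ^ 2 * E₂ - ((q:ℂ) + (q:ℂ)⁻¹) • (E₁ * E₂ * E₁) + E₂ * E₁ ^ 2 = 0
  serreE₂ : E₂ ^ 2 * E₁ - ((q:ℂ) + (q:ℂ)⁻¹) • (E₂ * E₁ * E₂) + E₁ * E₂ ^ 2 = 0
  serreF₁ : F₁ ^ 2 * F₂ - ((q:ℂ) + (q:ℂ)⁻¹) • (F₁ * F₂ * F₁) + F₂ * F₁ ^ 2 = 0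
  serreF₂ : F₂ ^ 2 * F₁ - ((q:ℂ) + (q:ℂ)⁻¹) • (F₂ * F₁ * F₂) + F₁ * F₂ ^ 2 = 0

/-- Rewriting a product `a * b` inside a right-associated word. -/
lemma mul_mul_of_mul_eq {R : Type*} [Semigroup R] {a b c : R} (h : a * b = c) (x : R) :
    a * (b * x) = c * x := by
  rw [← mul_assoc, h]

/-- Rewriting a product `a * (b * c)` inside a right-associated word. -/
lemma mul_mul_mul_of_mul_mul_eq {R : Type*} [Semigroup R] {a b c d : R} (h : a * (b * c) = d)
    (x : R) : a * (b * (c * x)) = d * x := by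
  rw [← h, mul_assoc, mul_assoc]

/-- If `k` and `x` commute up to a nonzero scalar, then so do the inverse of `k` and `x`. -/
lemma inv_mul_eq_smul_of_mul_eq_smul {R : Type*} [Ring R] [Algebra ℂ R] {k k' x : R} {r s : ℂ}
    (hk : k * k' = 1) (hk' : k' * k = 1) (hsr : s * r = 1) (h : k * x = r • (x * k)) :
    k' * x = s • (x * k') := by
  calc k' * x = s • (k' * (r • (x * k)) * k') := by
        simp only [mul_smul_comm, smul_mul_assoc, smul_smul, hsr, one_smul, mul_assoc, hk, mul_one]
    _ = s • (x * k') := by rw [← h, ← mul_assoc k' k x, hk', one_mul]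

theorem stmt {R : Type*} [Ring R] [Algebra ℂ R] (q : ℝ) (hq0 : 0 < q) (hq1 : q < 1)
    (c₁ c₂ : ℂ) (hc₁ : c₁ ≠ 0) (hc₂ : c₂ ≠ 0)
    (E₁ E₂ F₁ F₂ K₁ K₁' K₂ K₂' : R)
    (h : UqSL3 R q E₁ E₂ F₁ F₂ K₁ K₁' K₂ K₂') (B₁ B₂ K K' C₁ : R)
    (hB₁ : B₁ = F₁ - c₁ • (E₂ * K₁')) (hB₂ : B₂ = F₂ - c₂ • (E₁ * K₂'))
    (hK : K = K₁ * K₂') (hK' : K' = K₁' * K₂)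
    (hC₁ : C₁ = B₁ * B₂ - (q:ℂ) • (B₂ * B₁)
      - (c₂ / ((q:ℂ) - (q:ℂ)⁻¹)) • K + ((((q:ℂ) + (q:ℂ)⁻¹) * c₁) / ((q:ℂ) - (q:ℂ)⁻¹)) • K') :
    K * B₁ = ((q:ℂ) ^ (-3:ℤ)) • (B₁ * K) ∧
    K * B₂ = ((q:ℂ) ^ (3:ℤ)) • (B₂ * K) ∧
    C₁ * B₁ = (q:ℂ) • (B₁ * C₁) ∧
    C₁ * B₂ = (q:ℂ)⁻¹ • (B₂ * C₁) := by
  have hQ : (q : ℂ) ≠ 0 := by exact_mod_cast hq0.ne'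
  have hQ1 : (q : ℂ) ^ 2 - 1 ≠ 0 := by
    have : q ^ 2 - 1 ≠ 0 := by nlinarith
    exact_mod_cast this
  obtain ⟨kk1, kk1', kk2, kk2', -, hk12', hk1'2, ke11, ke12, ke21, ke22, kf11, kf12, kf21, kf22,
    hef11, hef22, ef12, ef21, hse1, hse2, hsf1, hsf2⟩ := h
  generalize (q : ℂ) = Q at *
  have k2'1' : K₂' * K₁' = K₁' * K₂' := by
    simpa using inv_mul_eq_smul_of_mul_eq_smul kk2 kk2' (mul_one (1 : ℂ)) (by simpa using hk1'2.symm)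
  have k2'1 := hk12'.symm
  have k21' := hk1'2.symm
  have le11 := inv_mul_eq_smul_of_mul_eq_smul kk1 kk1' (inv_mul_cancel₀ (zpow_ne_zero _ hQ)) ke11
  have le12 := inv_mul_eq_smul_of_mul_eq_smul kk1 kk1' (inv_mul_cancel₀ (zpow_ne_zero _ hQ)) ke12
  have le21 := inv_mul_eq_smul_of_mul_eq_smul kk2 kk2' (inv_mul_cancel₀ (zpow_ne_zero _ hQ)) ke21
  have le22 := inv_mul_eq_smul_of_mul_eq_smul kk2 kk2' (inv_mul_cancel₀ (zpow_ne_zero _ hQ)) ke22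
  have lf11 := inv_mul_eq_smul_of_mul_eq_smul kk1 kk1' (inv_mul_cancel₀ (zpow_ne_zero _ hQ)) kf11
  have lf12 := inv_mul_eq_smul_of_mul_eq_smul kk1 kk1' (inv_mul_cancel₀ (zpow_ne_zero _ hQ)) kf12
  have lf21 := inv_mul_eq_smul_of_mul_eq_smul kk2 kk2' (inv_mul_cancel₀ (zpow_ne_zero _ hQ)) kf21
  have lf22 := inv_mul_eq_smul_of_mul_eq_smul kk2 kk2' (inv_mul_cancel₀ (zpow_ne_zero _ hQ)) kf22
  have ef11 := sub_eq_iff_eq_add'.1 hef11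
  have ef22 := sub_eq_iff_eq_add'.1 hef22
  have se1 : E₁ * (E₁ * E₂) = (Q + Q⁻¹) • (E₁ * (E₂ * E₁)) - E₂ * (E₁ * E₁) := by
    rw [← sub_eq_zero, ← hse1]; simp only [pow_two, mul_assoc]; abel
  have se2 : E₁ * (E₂ * E₂) = (Q + Q⁻¹) • (E₂ * (E₁ * E₂)) - E₂ * (E₂ * E₁) := by
    rw [← sub_eq_zero, ← hse2]; simp only [pow_two, mul_assoc]; abel
  have sf1 : F₁ * (F₁ * F₂) = (Q + Q⁻¹) • (F₁ * (F₂ * F₁)) - F₂ * (F₁ * F₁) := by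
    rw [← sub_eq_zero, ← hsf1]; simp only [pow_two, mul_assoc]; abel
  have sf2 : F₁ * (F₂ * F₂) = (Q + Q⁻¹) • (F₂ * (F₁ * F₂)) - F₂ * (F₂ * F₁) := by
    rw [← sub_eq_zero, ← hsf2]; simp only [pow_two, mul_assoc]; abel
  subst hC₁ hB₁ hB₂ hK hK'
  refine ⟨?_, ?_, ?_, ?_⟩
  all_goals
    simp only [mul_add, add_mul, mul_sub, sub_mul, smul_add, smul_sub, mul_smul_comm,
      smul_mul_assoc, smul_smul, mul_assoc, one_mul, mul_one, kk2, kk2', k21', k2'1', kf21, kf22,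
      le11, lf11, lf12, lf21, lf22, sf1, sf2, mul_mul_of_mul_eq kk1, mul_mul_of_mul_eq kk1',
      mul_mul_of_mul_eq k21', mul_mul_of_mul_eq k2'1, mul_mul_of_mul_eq k2'1',
      mul_mul_of_mul_eq ke11, mul_mul_of_mul_eq ke12, mul_mul_of_mul_eq ke21,
      mul_mul_of_mul_eq ke22, mul_mul_of_mul_eq kf11, mul_mul_of_mul_eq kf12,
      mul_mul_of_mul_eq kf21, mul_mul_of_mul_eq le11, mul_mul_of_mul_eq le12,
      mul_mul_of_mul_eq le21, mul_mul_of_mul_eq le22, mul_mul_of_mul_eq lf11,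
      mul_mul_of_mul_eq lf12, mul_mul_of_mul_eq lf21, mul_mul_of_mul_eq lf22,
      mul_mul_of_mul_eq ef11, mul_mul_of_mul_eq ef22, mul_mul_of_mul_eq ef12,
      mul_mul_of_mul_eq ef21, mul_mul_mul_of_mul_mul_eq se1, mul_mul_mul_of_mul_mul_eq se2]
    match_scalars <;> field_simp <;> ring
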